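/- arXiv:1411.1460 — 5 statements merged into one kernel-verified Lean document; each statement's English description precedes it below -/
import Mathlib

section
/- For every initial predictor state s and every natural number n ≥ 3, after processing the outcome sequence loopSeq n (the n+1 evaluations of a simple sequential loop's condition, taken n times and then not taken once) the 2-bit predictor ends in the Weakly-Taken state: run s (loopSeq n) = 2. -/
/-- One update of the 2-bit saturating-counter branch predictor:
states `0,1,2,3` = Strongly-Not-Taken, Weakly-Not-Taken, Weakly-Taken, Strongly-Taken. -/
def step (s : ℕ) (b : Bool) : ℕ := if b then min (s + 1) 3 else s - 1

/-- Final predictor state after processing the outcome list `L` from initial state `s`. -/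
def run (s : ℕ) (L : List Bool) : ℕ := L.foldl step s

/-- Number of mispredictions: positions `i` where the prediction (`taken` iff state ≥ 2)
of the state after the first `i` outcomes differs from the actual outcome `L.get i`. -/
def misses (s : ℕ) (L : List Bool) : ℕ :=
  (List.finRange L.length).countP (fun i : Fin L.length => decide (2 ≤ run s (L.take i.val)) != L.get i)

/-- Outcome list of the condition branch of a simple sequential loop executing `n` times. -/
def loopSeq (n : ℕ) : List Bool := List.replicate n true ++ [false]

theorem foldl_true (n s : ℕ) (hs : s ≤ 3) :
    (List.replicate n true).foldl step s = min (s + n) 3 := by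
  induction n generalizing s with
  | zero => simp; omega
  | succ k ih =>
    rw [List.replicate_succ, List.foldl_cons, ih _ (by simp [step])]
    simp only [step, if_true]
    omega

theorem stmt0 (s n : ℕ) (hs : s ≤ 3) (hn : 3 ≤ n) : run s (loopSeq n) = 2 := by
  rw [run, loopSeq, List.foldl_append, foldl_true n s hs]
  have h : min (s + n) 3 = 3 := by omega
  rw [h]
  rfl
end

section
/- Suppose an inner loop is executed k ≥ 2 times in succession, where the first execution runs n₁ ≥ 3 iterations and every subsequent execution runs nᵢ ≥ 1 iterations. Then for every initial predictor state s, the total number of mispredictions of the inner loop's condition branch is at most k + 2. Formally: for every nonempty list ns : List ℕ with ns.head ≥ 3 and every element of ns.tail at least 1, and every initial state s, misses s ((ns.map loopSeq).flatten) ≤ ns.length + 2. -/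
theorem misses_nil (s : ℕ) : misses s [] = 0 := by simp [misses]

theorem misses_cons (s : ℕ) (b : Bool) (L : List Bool) :
    misses s (b :: L) = (if (decide (2 ≤ s) != b) = true then 1 else 0) + misses (step s b) L := by
  unfold misses
  have e : List.finRange (b :: L).length = 0 :: (List.finRange L.length).map Fin.succ :=
    List.finRange_succ
  rw [e, List.countP_cons, List.countP_map, add_comm]
  congr 1

theorem misses_three (m : ℕ) (L : List Bool) :
    misses 3 (List.replicate m true ++ false :: L) = 1 + misses 2 L := by
  induction m with
  | zero => simp [misses_cons, step]
  | succ k ih =>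
    rw [List.replicate_succ, List.cons_append, misses_cons]
    simpa [step] using ih

theorem misses_rest (rest : List ℕ) (hrest : ∀ m ∈ rest, 1 ≤ m) :
    misses 2 ((rest.map loopSeq).flatten) = rest.length := by
  induction rest with
  | nil => simp [misses_nil]
  | cons m r ih =>
    have h1 : 1 ≤ m := hrest m (by simp)
    have h2 := ih (fun x hx => hrest x (by simp [hx]))
    obtain ⟨k, rfl⟩ := Nat.exists_eq_add_of_le' h1
    have h3 := misses_three k ((r.map loopSeq).flatten)
    simp only [List.map_cons, List.flatten_cons, loopSeq, List.append_assoc, List.singleton_append,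
      List.replicate_succ, List.cons_append, misses_cons, List.length_cons] at *
    simp [step] at *
    omega

theorem stmt5 (n : ℕ) (rest : List ℕ) (hn : 3 ≤ n) (hrest : ∀ m ∈ rest, 1 ≤ m)
    (s : ℕ) (hs : s ≤ 3) :
    misses s (((n :: rest).map loopSeq).flatten) ≤ (n :: rest).length + 2 := by
  obtain ⟨k, rfl⟩ := Nat.exists_eq_add_of_le' hn
  have h2 := misses_rest rest hrest
  have h3 := misses_three k ((rest.map loopSeq).flatten)
  have e : (((k + 3) :: rest).map loopSeq).flatten = true :: true :: true ::
      (List.replicate k true ++ false :: (rest.map loopSeq).flatten) := by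
    simp [loopSeq, List.replicate_succ]
  rw [e, misses_cons, misses_cons, misses_cons, List.length_cons]
  interval_cases s <;> simp [step, h3, h2] <;> omega
end

section
/- In the synchronous Shiloach–Vishkin label propagation, after t iterations the label of each vertex v equals the minimum initial label over all vertices within graph distance t of v: for all t : ℕ and v : V, iter t v = the minimum of L0 u over the set {u : V | G.edist u v ≤ t} (this set is finite and nonempty, since it contains v). -/
open scoped Classical

/-- Synchronous Shiloach–Vishkin label propagation: at each step, each vertex takes the
minimum of its own label and the labels of its neighbors. -/
def iterSV {V : Type*} [Fintype V] [DecidableEq V] (G : SimpleGraph V) [DecidableRel G.Adj]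
    (L0 : V → ℕ) : ℕ → V → ℕ
  | 0 => L0
  | t + 1 => fun v =>
      (insert v (G.neighborFinset v)).inf' (Finset.insert_nonempty _ _) (iterSV G L0 t)

theorem edist_succ_iff_aux {V : Type*} (G : SimpleGraph V) (u v : V) (t : ℕ) :
    G.edist u v ≤ ((t + 1 : ℕ) : ℕ∞) ↔ ∃ w, (w = v ∨ G.Adj v w) ∧ G.edist u w ≤ (t : ℕ∞) := by
  constructor
  · intro h
    rw [SimpleGraph.edist_comm] at h
    have hne : G.edist v u ≠ ⊤ := ne_top_of_le_ne_top (ENat.natCast_ne_top _) h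
    obtain ⟨p, hp⟩ := SimpleGraph.exists_walk_of_edist_ne_top hne
    rw [← hp] at h
    have h' : p.length ≤ t + 1 := by exact_mod_cast h
    clear hp h hne
    cases p with
    | nil => exact ⟨u, Or.inl rfl, by simp⟩
    | cons hadj q =>
      refine ⟨_, Or.inr hadj, ?_⟩
      rw [SimpleGraph.edist_comm]
      refine (SimpleGraph.edist_le q).trans ?_
      simp only [SimpleGraph.Walk.length_cons] at h'
      exact_mod_cast (by omega : q.length ≤ t)
  · rintro ⟨w, hw, h⟩
    have h1 : G.edist w v ≤ 1 :=
      SimpleGraph.edist_le_one_iff_adj_or_eq.2 (hw.elim Or.inr (fun a => Or.inl a.symm))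
    push_cast
    exact (SimpleGraph.edist_triangle (v := w)).trans (add_le_add h h1)

theorem le_iterSV_iff_aux {V : Type*} [Fintype V] [DecidableEq V] (G : SimpleGraph V)
    [DecidableRel G.Adj] (L0 : V → ℕ) (n t : ℕ) (v : V) :
    n ≤ iterSV G L0 t v ↔ ∀ u, G.edist u v ≤ (t : ℕ∞) → n ≤ L0 u := by
  induction t generalizing v with
  | zero => simp [iterSV]
  | succ t ih =>
    simp only [iterSV, Finset.le_inf'_iff, Finset.mem_insert, SimpleGraph.mem_neighborFinset,
      edist_succ_iff_aux, ih]
    exact ⟨fun h u ⟨w, hw, hu⟩ => h w hw u hu, fun h w hw u hu => h u ⟨w, hw, hu⟩⟩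

theorem stmt11 {V : Type*} [Fintype V] [DecidableEq V] (G : SimpleGraph V)
    [DecidableRel G.Adj] (L0 : V → ℕ) (t : ℕ) (v : V) :
    iterSV G L0 t v =
      (Finset.univ.filter (fun u => G.edist u v ≤ t)).inf'
        ⟨v, by simp [SimpleGraph.edist_self]⟩ L0 := by
  refine eq_of_forall_le_iff fun n => ?_
  refine (le_iterSV_iff_aux G L0 n t v).trans (Iff.trans ?_ (Finset.le_inf'_iff _ _).symm)
  simp
end

section
/- If the simple graph G is connected and every pair of vertices is at graph distance at most d (i.e., d bounds the diameter of G), then after d iterations of the synchronous Shiloach–Vishkin label propagation every vertex carries the global minimum initial label: for all v : V, iter d v = the minimum of L0 u over all u : V. In particular, label propagation in the Shiloach–Vishkin algorithm terminates within d iterations on a connected graph. -/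
theorem iterSV_ge {V : Type*} [Fintype V] [DecidableEq V] [Nonempty V] (G : SimpleGraph V)
    [DecidableRel G.Adj] (L0 : V → ℕ) (t : ℕ) : ∀ v : V,
    Finset.univ.inf' Finset.univ_nonempty L0 ≤ iterSV G L0 t v := by
  induction t with
  | zero => intro v; exact Finset.inf'_le _ (Finset.mem_univ v)
  | succ t ih =>
    intro v
    exact Finset.le_inf' (Finset.insert_nonempty _ _) _ (fun u _ => ih u)

theorem iterSV_le {V : Type*} [Fintype V] [DecidableEq V] (G : SimpleGraph V)
    [DecidableRel G.Adj] (L0 : V → ℕ) {v u : V} (p : G.Walk v u) : ∀ t : ℕ,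
    p.length ≤ t → iterSV G L0 t v ≤ L0 u := by
  induction p with
  | nil =>
    rename_i w
    intro t _
    induction t with
    | zero => exact le_rfl
    | succ t ih =>
      exact (Finset.inf'_le _ (Finset.mem_insert_self _ _)).trans (ih (Nat.zero_le _))
  | cons h p ih =>
    intro t ht
    rw [SimpleGraph.Walk.length_cons] at ht
    obtain ⟨s, rfl⟩ : ∃ s, t = s + 1 := ⟨t - 1, by omega⟩
    refine (Finset.inf'_le _ (Finset.mem_insert_of_mem ?_)).trans (ih s (by omega))
    exact (G.mem_neighborFinset _ _).2 h

theorem stmt12 {V : Type*} [Fintype V] [DecidableEq V] [Nonempty V] (G : SimpleGraph V)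
    [DecidableRel G.Adj] (L0 : V → ℕ) (d : ℕ)
    (hconn : G.Connected) (hdiam : ∀ u v : V, G.edist u v ≤ d) (v : V) :
    iterSV G L0 d v = Finset.univ.inf' Finset.univ_nonempty L0 := by
  refine le_antisymm ?_ (iterSV_ge G L0 d v)
  refine Finset.le_inf' _ _ (fun u _ => ?_)
  obtain ⟨p, hp⟩ := (hconn v u).exists_walk_length_eq_edist
  refine iterSV_le G L0 p d ?_
  have := hdiam v u
  rw [← hp] at this
  exact_mod_cast this
end

section
/- After |V| iterations of the synchronous Shiloach–Vishkin label propagation, the label of each vertex v equals the minimum initial label over its connected component: iter (Fintype.card V) v = the minimum of L0 u over the set {u : V | G.Reachable u v}. -/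
open scoped Classical

theorem iterSV_le_walk {V : Type*} [Fintype V] [DecidableEq V] (G : SimpleGraph V)
    [DecidableRel G.Adj] (L0 : V → ℕ) : ∀ (t : ℕ) (v u : V) (p : G.Walk v u),
    p.length ≤ t → iterSV G L0 t v ≤ L0 u := by
  intro t
  induction t with
  | zero =>
    intro v u p hp
    cases p with
    | nil => exact le_rfl
    | cons h q => simp at hp
  | succ t ih =>
    intro v u p hp
    cases p with
    | nil =>
      exact (Finset.inf'_le _ (Finset.mem_insert_self _ _)).trans
        (ih v v SimpleGraph.Walk.nil (by simp))
    | @cons _ w _ h q =>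
      refine (Finset.inf'_le (b := w) _ ?_).trans (ih w u q ?_)
      · simp [h]
      · simpa using hp

theorem iterSV_exists {V : Type*} [Fintype V] [DecidableEq V] (G : SimpleGraph V)
    [DecidableRel G.Adj] (L0 : V → ℕ) : ∀ (t : ℕ) (v : V),
    ∃ u, G.Reachable u v ∧ iterSV G L0 t v = L0 u := by
  intro t
  induction t with
  | zero => exact fun v => ⟨v, SimpleGraph.Reachable.refl v, rfl⟩
  | succ t ih =>
    intro v
    obtain ⟨w, hw, he⟩ := Finset.exists_mem_eq_inf' (s := insert v (G.neighborFinset v))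
      (Finset.insert_nonempty _ _) (iterSV G L0 t)
    obtain ⟨u, hu, hl⟩ := ih w
    refine ⟨u, ?_, he.trans hl⟩
    rcases Finset.mem_insert.1 hw with rfl | h
    · exact hu
    · exact hu.trans ((G.mem_neighborFinset v w).1 h).symm.reachable

theorem stmt14 {V : Type*} [Fintype V] [DecidableEq V] (G : SimpleGraph V)
    [DecidableRel G.Adj] (L0 : V → ℕ) (v : V) :
    iterSV G L0 (Fintype.card V) v =
      (Finset.univ.filter (fun u => G.Reachable u v)).inf'
        ⟨v, by simp [SimpleGraph.Reachable.refl]⟩ L0 := by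
  apply le_antisymm
  · apply Finset.le_inf'
    intro u hu
    obtain ⟨p, hp⟩ := (Finset.mem_filter.1 hu).2.symm.exists_isPath
    exact iterSV_le_walk G L0 _ v u p hp.length_lt.le
  · obtain ⟨u, hu, he⟩ := iterSV_exists G L0 (Fintype.card V) v
    rw [he]
    apply Finset.inf'_le L0
    exact Finset.mem_filter.2 ⟨Finset.mem_univ _, hu⟩
end
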